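/- If P is a projection matrix (P^2 = P) on a finite-dimensional real inner product space with P ≠ 0 and P ≠ I, then the operator norm of I - P equals the operator norm of P. -/

import Mathlib

/-- A nonzero idempotent continuous linear map has operator norm at least one. -/
lemma one_le_opNorm_of_idempotent {E : Type*} [NormedAddCommGroup E] [NormedSpace ℝ E]
    {P : E →L[ℝ] E} (hP : P ∘L P = P) (h0 : P ≠ 0) : 1 ≤ ‖P‖ := by
  have h := ContinuousLinearMap.opNorm_comp_le P P
  rw [hP] at h
  exact le_of_mul_le_mul_right (by simpa using h) (norm_pos_iff.mpr h0)

/-- Rescaling two nonzero vectors so as to swap their norms preserves the norm of their sum. -/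
lemma norm_smul_add_smul_swap {E : Type*} [NormedAddCommGroup E] [InnerProductSpace ℝ E]
    {u v : E} (hu : u ≠ 0) (hv : v ≠ 0) :
    ‖(‖v‖ / ‖u‖) • u + (‖u‖ / ‖v‖) • v‖ = ‖u + v‖ := by
  have hu' := norm_ne_zero_iff.mpr hu
  have hv' := norm_ne_zero_iff.mpr hv
  rw [← sq_eq_sq₀ (norm_nonneg _) (norm_nonneg _), norm_add_sq_real, norm_add_sq_real,
    real_inner_smul_left, real_inner_smul_right, norm_smul, norm_smul]
  simp only [norm_div, norm_norm]
  field_simp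
  ring

/-- The complement of a nonzero idempotent is bounded by the norm of that idempotent. -/
lemma opNorm_id_sub_le_of_idempotent {E : Type*} [NormedAddCommGroup E] [InnerProductSpace ℝ E]
    {P : E →L[ℝ] E} (hP : P ∘L P = P) (h0 : P ≠ 0) :
    ‖ContinuousLinearMap.id ℝ E - P‖ ≤ ‖P‖ := by
  refine ContinuousLinearMap.opNorm_le_bound _ (norm_nonneg _) fun x => ?_
  have hPP : P (P x) = P x := congrArg (fun T : E →L[ℝ] E => T x) hP
  change ‖x - P x‖ ≤ ‖P‖ * ‖x‖
  by_cases hu : P x = 0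
  · rw [hu, sub_zero]
    exact le_mul_of_one_le_left (norm_nonneg _) (one_le_opNorm_of_idempotent hP h0)
  by_cases hv : x - P x = 0
  · rw [hv, norm_zero]
    positivity
  have h := P.le_opNorm ((‖x - P x‖ / ‖P x‖) • P x + (‖P x‖ / ‖x - P x‖) • (x - P x))
  rw [norm_smul_add_smul_swap hu hv, add_sub_cancel] at h
  simpa [hPP, norm_smul, div_mul_cancel₀ _ (norm_ne_zero_iff.mpr hu)] using h

/-- If `P` is a projection (`P ∘ P = P`) on a finite-dimensional real inner product space
with `P ≠ 0` and `P ≠ I`, then the operator norm of `I - P` equals the operator norm of `P`. -/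
theorem opNorm_id_sub_projection_eq_opNorm
    {E : Type*} [NormedAddCommGroup E] [InnerProductSpace ℝ E] [FiniteDimensional ℝ E]
    (P : E →L[ℝ] E) (hP : P ∘L P = P) (h0 : P ≠ 0)
    (h1 : P ≠ ContinuousLinearMap.id ℝ E) :
    ‖ContinuousLinearMap.id ℝ E - P‖ = ‖P‖ := by
  refine le_antisymm (opNorm_id_sub_le_of_idempotent hP h0) ?_
  have hQ : (ContinuousLinearMap.id ℝ E - P) ∘L (ContinuousLinearMap.id ℝ E - P) =
      ContinuousLinearMap.id ℝ E - P := by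
    simp [ContinuousLinearMap.sub_comp, ContinuousLinearMap.comp_sub, hP]
  simpa using opNorm_id_sub_le_of_idempotent hQ (sub_ne_zero.mpr h1.symm)
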